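/- arXiv:1804.08512 — 2 statements merged into one kernel-verified Lean document; each statement's English description precedes it below -/
import Mathlib

section
/- Let G ∈ W₊^{m×p} (Wiener class) with T_G T_G* strictly positive. For V ∈ W₊^{(p−m)×m} and X(z) = Y(z)Ξ₀ + Y(z)Θ₀ V(z), one has ‖X(·)u‖²_{H²_p} = ‖Y(·)Ξ₀ u‖²_{H²_p} + ‖V(·)u‖²_{H²_{p−m}} for every u ∈ ℂᵐ. In particular, Ξ(z) = Y(z)Ξ₀ is the least squares solution of the Wiener–Bezout problem: for every Wiener solution X of G(z)X(z) = I_m and every u ∈ ℂᵐ, ‖Ξ(·)u‖_{H²_p} ≤ ‖X(·)u‖_{H²_p}. -/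
/-!
Setting: `l2 n` models ℓ²₊(ℂⁿ); `lp.single 2 0` is the canonical embedding `E_n`, and
evaluating a sequence at coordinate `k` realizes `E_n* (S_n*)^k`.  Block Toeplitz and
Hankel operators, as well as the (bounded) inverse of `T_G T_G*`, are specified through
their actions on the standard basis vectors of the coordinate spaces.
-/

noncomputable section
open scoped Matrix

/-- ℂⁿ with the Euclidean norm. -/
abbrev ES (n : ℕ) : Type := EuclideanSpace ℂ (Fin n)

/-- ℓ²₊(ℂⁿ). -/
abbrev l2 (n : ℕ) : Type := lp (fun _ : ℕ => ES n) 2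

/-- The `b`-th standard basis vector of ℂⁿ. -/
abbrev eVec (n : ℕ) (b : Fin n) : ES n := EuclideanSpace.single b 1

/-- The matrix function `z ↦ ∑' ν, z ^ ν • F ν` determined by a coefficient sequence. -/
def seriesM {r s : ℕ} (F : ℕ → Matrix (Fin r) (Fin s) ℂ) (z : ℂ) :
    Matrix (Fin r) (Fin s) ℂ :=
  Matrix.of fun a b => ∑' ν : ℕ, z ^ ν * F ν a b

section Series

/-- An absolutely summable sequence whose power series vanishes on the unit disc is zero. -/
theorem eq_zero_of_tsum_pow_mul_eq_zero {c : ℕ → ℂ} (hc : Summable fun ν => ‖c ν‖)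
    (h : ∀ z ∈ Metric.ball (0 : ℂ) 1, ∑' ν, z ^ ν * c ν = 0) : c = 0 := by
  have hfp : HasFPowerSeriesAt (fun _ : ℂ => (0 : ℂ))
      (FormalMultilinearSeries.ofScalars ℂ c) 0 := by
    rw [hasFPowerSeriesAt_iff]
    filter_upwards [Metric.ball_mem_nhds (0 : ℂ) one_pos] with z hz
    simp only [FormalMultilinearSeries.coeff_ofScalars, smul_eq_mul]
    rw [← h z hz]
    refine (Summable.of_norm_bounded hc fun ν => ?_).hasSum
    rw [norm_mul, norm_pow]
    have hz' : ‖z‖ ≤ 1 := by simpa using (Metric.mem_ball.1 hz).le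
    exact mul_le_of_le_one_left (norm_nonneg _) (pow_le_one₀ (norm_nonneg _) hz')
  exact (FormalMultilinearSeries.ofScalars_series_eq_zero ℂ).1 hfp.eq_zero

/-- Entrywise absolute summability of the coefficients (the Wiener class). -/
def IsWiener {r s : ℕ} (F : ℕ → Matrix (Fin r) (Fin s) ℂ) : Prop :=
  ∀ a b, Summable fun ν => ‖F ν a b‖

/-- The Cauchy product of two sequences of matrices. -/
def cauchyMul {r s t : ℕ} (F : ℕ → Matrix (Fin r) (Fin s) ℂ)
    (K : ℕ → Matrix (Fin s) (Fin t) ℂ) (n : ℕ) : Matrix (Fin r) (Fin t) ℂ :=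
  ∑ ij ∈ Finset.HasAntidiagonal.antidiagonal n, F ij.1 * K ij.2

theorem cauchyMul_apply {r s t : ℕ} (F : ℕ → Matrix (Fin r) (Fin s) ℂ)
    (K : ℕ → Matrix (Fin s) (Fin t) ℂ) (n : ℕ) (a : Fin r) (b : Fin t) :
    cauchyMul F K n a b
      = ∑ c, ∑ ij ∈ Finset.HasAntidiagonal.antidiagonal n, F ij.1 a c * K ij.2 c b := by
  rw [Finset.sum_comm, cauchyMul, Matrix.sum_apply]
  simp only [Matrix.mul_apply]

namespace IsWiener

variable {r s t : ℕ} {F K : ℕ → Matrix (Fin r) (Fin s) ℂ} {L : ℕ → Matrix (Fin s) (Fin t) ℂ}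

theorem summable_pow_mul (hF : IsWiener F) {z : ℂ} (hz : z ∈ Metric.ball (0 : ℂ) 1)
    (a : Fin r) (b : Fin s) : Summable fun ν => ‖z ^ ν * F ν a b‖ := by
  refine (hF a b).of_nonneg_of_le (fun _ => norm_nonneg _) fun ν => ?_
  rw [norm_mul, norm_pow]
  have hz' : ‖z‖ ≤ 1 := by simpa using (Metric.mem_ball.1 hz).le
  exact mul_le_of_le_one_left (norm_nonneg _) (pow_le_one₀ (norm_nonneg _) hz')

theorem mul_const (hF : IsWiener F) (M : Matrix (Fin s) (Fin t) ℂ) :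
    IsWiener fun ν => F ν * M := by
  intro a b
  refine Summable.of_nonneg_of_le (fun _ => norm_nonneg _) (fun ν => ?_)
    (summable_sum fun c (_ : c ∈ Finset.univ) => (hF a c).mul_right ‖M c b‖)
  change ‖(F ν * M) a b‖ ≤ _
  rw [Matrix.mul_apply]
  exact (norm_sum_le _ _).trans_eq (by simp only [norm_mul])

theorem add (hF : IsWiener F) (hK : IsWiener K) : IsWiener fun ν => F ν + K ν := fun a b =>
  Summable.of_nonneg_of_le (fun _ => norm_nonneg _) (fun _ => norm_add_le _ _)
    ((hF a b).add (hK a b))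

theorem cauchyMul (hF : IsWiener F) (hL : IsWiener L) : IsWiener (cauchyMul F L) := by
  intro a b
  simp only [cauchyMul_apply]
  exact Summable.of_nonneg_of_le (fun _ => norm_nonneg _) (fun ν => norm_sum_le _ _)
    (summable_sum fun c (_ : c ∈ Finset.univ) =>
      summable_norm_sum_mul_antidiagonal_of_summable_norm
        (f := fun ν => F ν a c) (g := fun ν => L ν c b) (hF a c) (hL c b))

theorem seriesM_mul_const (hF : IsWiener F) (M : Matrix (Fin s) (Fin t) ℂ) {z : ℂ}
    (hz : z ∈ Metric.ball (0 : ℂ) 1) :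
    seriesM (fun ν => F ν * M) z = seriesM F z * M := by
  ext a b
  simp only [seriesM, Matrix.of_apply, Matrix.mul_apply, Finset.mul_sum]
  rw [Summable.tsum_finsetSum fun c _ => ?_]
  · refine Finset.sum_congr rfl fun c _ => ?_
    rw [← tsum_mul_right]
    simp only [mul_assoc]
  · simpa only [mul_assoc] using ((hF.summable_pow_mul hz a c).of_norm).mul_right (M c b)

theorem seriesM_add (hF : IsWiener F) (hK : IsWiener K) {z : ℂ}
    (hz : z ∈ Metric.ball (0 : ℂ) 1) :
    seriesM (fun ν => F ν + K ν) z = seriesM F z + seriesM K z := by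
  ext a b
  simp only [seriesM, Matrix.of_apply, Matrix.add_apply, mul_add]
  exact (hF.summable_pow_mul hz a b).of_norm.tsum_add (hK.summable_pow_mul hz a b).of_norm

theorem seriesM_cauchyMul (hF : IsWiener F) (hL : IsWiener L) {z : ℂ}
    (hz : z ∈ Metric.ball (0 : ℂ) 1) :
    seriesM (_root_.cauchyMul F L) z = seriesM F z * seriesM L z := by
  have key (a : Fin r) (b : Fin t) (n : ℕ) : z ^ n * _root_.cauchyMul F L n a b
      = ∑ c, ∑ ij ∈ Finset.HasAntidiagonal.antidiagonal n,
          (z ^ ij.1 * F ij.1 a c) * (z ^ ij.2 * L ij.2 c b) := by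
    rw [cauchyMul_apply, Finset.mul_sum]
    refine Finset.sum_congr rfl fun c _ => ?_
    rw [Finset.mul_sum]
    refine Finset.sum_congr rfl fun ij hij => ?_
    rw [← Finset.HasAntidiagonal.mem_antidiagonal.1 hij, pow_add]
    ring
  ext a b
  simp only [seriesM, Matrix.of_apply, Matrix.mul_apply, key]
  rw [Summable.tsum_finsetSum fun c _ => (summable_norm_sum_mul_antidiagonal_of_summable_norm
    (f := fun ν => z ^ ν * F ν a c) (g := fun ν => z ^ ν * L ν c b)
    (hF.summable_pow_mul hz a c) (hL.summable_pow_mul hz c b)).of_norm]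
  exact Finset.sum_congr rfl fun c _ =>
    (tsum_mul_tsum_eq_tsum_sum_antidiagonal_of_summable_norm
      (f := fun ν => z ^ ν * F ν a c) (g := fun ν => z ^ ν * L ν c b)
      (hF.summable_pow_mul hz a c) (hL.summable_pow_mul hz c b)).symm

theorem eq_of_seriesM_eq (hF : IsWiener F) (hK : IsWiener K)
    (h : ∀ z ∈ Metric.ball (0 : ℂ) 1, seriesM F z = seriesM K z) : F = K := by
  funext ν
  ext a b
  refine sub_eq_zero.1 (congrFun (eq_zero_of_tsum_pow_mul_eq_zero
    (c := fun ν => F ν a b - K ν a b) ?_ fun z hz => ?_) ν)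
  · exact Summable.of_nonneg_of_le (fun _ => norm_nonneg _) (fun _ => norm_sub_le _ _)
      ((hF a b).add (hK a b))
  · simp only [mul_sub]
    rw [(hF.summable_pow_mul hz a b).of_norm.tsum_sub (hK.summable_pow_mul hz a b).of_norm]
    exact sub_eq_zero.2 (congrFun (congrFun (h z hz) a) b)

end IsWiener

end Series

section Shift

variable {n : ℕ}

/-- Prepend a zero to a sequence. -/
def consZero (x : ℕ → ES n) : ℕ → ES n
  | 0 => 0
  | k + 1 => x k

theorem hasSum_norm_sq (x : l2 n) : HasSum (fun k => ‖x k‖ ^ 2) (‖x‖ ^ 2) := by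
  simpa using lp.hasSum_norm (p := 2) (by norm_num) x

/-- The forward shift on `ℓ²₊(ℂⁿ)`. -/
def shift (n : ℕ) : l2 n →ₗᵢ[ℂ] l2 n where
  toFun x := ⟨consZero x, memℓp_gen <| by
    rw [← summable_nat_add_iff 1]
    simpa [consZero] using (hasSum_norm_sq x).summable⟩
  map_add' x y := by
    ext k : 2
    cases k
    exacts [(add_zero (0 : ES n)).symm, rfl]
  map_smul' c x := by
    ext k : 2
    cases k
    exacts [(smul_zero c : c • (0 : ES n) = 0).symm, rfl]
  norm_map' x := by
    rw [← sq_eq_sq₀ (norm_nonneg _) (norm_nonneg _)]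
    refine (hasSum_norm_sq _).unique ((hasSum_nat_add_iff' 1).1 ?_)
    simpa [consZero] using hasSum_norm_sq x

@[simp]
theorem shift_apply_zero (x : l2 n) : shift n x 0 = 0 := rfl

@[simp]
theorem shift_apply_succ (x : l2 n) (k : ℕ) : shift n x (k + 1) = x k := rfl

theorem shift_single (k : ℕ) (e : ES n) :
    shift n (lp.single 2 k e) = lp.single 2 (k + 1) e := by
  ext i : 2
  cases i with
  | zero => simp [lp.single_apply]
  | succ i => simp [lp.single_apply, Pi.single_apply]

theorem shift_iterate_apply (x : l2 n) (k i : ℕ) :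
    ((shift n)^[k] x) i = if k ≤ i then x (i - k) else 0 := by
  induction k generalizing i with
  | zero => simp
  | succ k ih =>
    rw [Function.iterate_succ_apply']
    cases i with
    | zero => simp
    | succ i => simp [ih]

theorem norm_shift_iterate (x : l2 n) (k : ℕ) : ‖(shift n)^[k] x‖ = ‖x‖ := by
  induction k with
  | zero => rfl
  | succ k ih => rw [Function.iterate_succ_apply', LinearIsometry.norm_map, ih]

theorem inner_shift_iterate (x y : l2 n) (k : ℕ) :
    inner ℂ ((shift n)^[k] x) ((shift n)^[k] y) = inner ℂ x y := by
  induction k with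
  | zero => rfl
  | succ k ih =>
    rw [Function.iterate_succ_apply', Function.iterate_succ_apply', LinearIsometry.inner_map_map,
      ih]

/-- The backward shift on `ℓ²₊(ℂⁿ)`. -/
def bshift (n : ℕ) : l2 n →L[ℂ] l2 n := (shift n).toContinuousLinearMap.adjoint

theorem inner_bshift_right (x y : l2 n) :
    inner ℂ x (bshift n y) = inner ℂ (shift n x) y :=
  ContinuousLinearMap.adjoint_inner_right _ _ _

theorem inner_single (k : ℕ) (e : ES n) (x : l2 n) :
    inner ℂ (lp.single 2 k e : l2 n) x = inner ℂ (e : ES n) (x k : ES n) :=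
  lp.inner_single_left (G := fun _ : ℕ => ES n) k e x

@[simp]
theorem bshift_apply (x : l2 n) (k : ℕ) : bshift n x k = x (k + 1) := by
  have h (e : ES n) : inner ℂ e (bshift n x k : ES n) = inner ℂ e (x (k + 1) : ES n) := by
    rw [← inner_single, inner_bshift_right, shift_single, inner_single]
  exact ext_inner_left (E := ES n) ℂ h

@[simp]
theorem bshift_shift (x : l2 n) : bshift n (shift n x) = x := by
  ext k : 2
  simp

theorem bshift_single_zero (e : ES n) : bshift n (lp.single 2 0 e) = 0 := by
  ext k : 2
  simp [lp.single_apply]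

theorem single_add_shift_bshift (x : l2 n) :
    lp.single 2 0 (x 0) + shift n (bshift n x) = x := by
  ext k : 2
  cases k <;> simp [lp.single_apply]

theorem clm_ext_of_single {F : Type*} [NormedAddCommGroup F] [NormedSpace ℂ F]
    {f g : l2 n →L[ℂ] F}
    (h : ∀ j b, f (lp.single 2 j (eVec n b)) = g (lp.single 2 j (eVec n b))) : f = g := by
  refine lp.ext_continuousLinearMap (by norm_num) fun j => ?_
  refine ContinuousLinearMap.coe_injective
    ((EuclideanSpace.basisFun (Fin n) ℂ).toBasis.ext fun b => ?_)
  simpa using h j b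

end Shift

section Operators

variable {m p : ℕ} {T H : l2 p →L[ℂ] l2 m} {R : l2 m →L[ℂ] l2 m}

theorem bshift_toeplitz (hTS : ∀ x, T (shift p x) = shift m (T x))
    (hTH : ∀ x, bshift m (T (lp.single 2 0 x)) = H (lp.single 2 0 x)) (x : l2 p) :
    bshift m (T x) = T (bshift p x) + H (lp.single 2 0 (x 0)) := by
  conv_lhs => rw [← single_add_shift_bshift x]
  rw [map_add, map_add, hTH, hTS, bshift_shift, add_comm]

theorem bshift_adjoint_toeplitz (hTS : ∀ x, T (shift p x) = shift m (T x)) (y : l2 m) :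
    bshift p (T.adjoint y) = T.adjoint (bshift m y) := by
  refine ext_inner_left ℂ fun x => ?_
  rw [inner_bshift_right, ContinuousLinearMap.adjoint_inner_right,
    ContinuousLinearMap.adjoint_inner_right, inner_bshift_right, hTS]

theorem bshift_rightInverse (hTS : ∀ x, T (shift p x) = shift m (T x))
    (hTH : ∀ x, bshift m (T (lp.single 2 0 x)) = H (lp.single 2 0 x))
    (hR1 : ∀ x, R (T (T.adjoint x)) = x) (hR2 : ∀ x, T (T.adjoint (R x)) = x) (y : l2 m) :
    bshift p (T.adjoint (R y)) = T.adjoint (R (bshift m y))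
      - T.adjoint (R (H (lp.single 2 0 ((T.adjoint (R y)) 0)))) := by
  have h := bshift_toeplitz hTS hTH (T.adjoint (R y))
  rw [hR2, bshift_adjoint_toeplitz hTS] at h
  rw [bshift_adjoint_toeplitz hTS, h, map_add, hR1, map_add, add_sub_cancel_right]

/-- The coefficient sequence of `Y(·)x`. -/
def yCol (T H : l2 p →L[ℂ] l2 m) (R : l2 m →L[ℂ] l2 m) (x : ES p) : l2 p :=
  lp.single 2 0 x - shift p (T.adjoint (R (H (lp.single 2 0 x))))

theorem rightInverse_single_eq_yCol (hTS : ∀ x, T (shift p x) = shift m (T x))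
    (hTH : ∀ x, bshift m (T (lp.single 2 0 x)) = H (lp.single 2 0 x))
    (hR1 : ∀ x, R (T (T.adjoint x)) = x) (hR2 : ∀ x, T (T.adjoint (R x)) = x) (u : ES m) :
    T.adjoint (R (lp.single 2 0 u)) = yCol T H R ((T.adjoint (R (lp.single 2 0 u))) 0) := by
  conv_lhs => rw [← single_add_shift_bshift (T.adjoint (R (lp.single 2 0 u)))]
  rw [bshift_rightInverse hTS hTH hR1 hR2, bshift_single_zero]
  simp [yCol, sub_eq_add_neg]

theorem single_sub_proj_eq_yCol (hTS : ∀ x, T (shift p x) = shift m (T x))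
    (hTH : ∀ x, bshift m (T (lp.single 2 0 x)) = H (lp.single 2 0 x))
    (hR1 : ∀ x, R (T (T.adjoint x)) = x) (hR2 : ∀ x, T (T.adjoint (R x)) = x) (x : ES p) :
    lp.single 2 0 x - T.adjoint (R (T (lp.single 2 0 x)))
      = yCol T H R (x - (T.adjoint (R (T (lp.single 2 0 x)))) 0) := by
  conv_lhs => rw [← single_add_shift_bshift (T.adjoint (R (T (lp.single 2 0 x))))]
  rw [bshift_rightInverse hTS hTH hR1 hR2, hTH]
  simp only [yCol, lp.single_sub, map_sub]
  abel

theorem toeplitz_shift_iterate (hTS : ∀ x, T (shift p x) = shift m (T x)) {x : l2 p}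
    (hx : T x = 0) (k : ℕ) : T ((shift p)^[k] x) = 0 := by
  induction k with
  | zero => exact hx
  | succ k ih => rw [Function.iterate_succ_apply', hTS, ih, map_zero]

/-- Convolution with an inner column family `θ` whose columns lie in `ker T` maps a summable
sequence `v` isometrically into `ker T`. -/
theorem exists_conv_of_inner {q : ℕ} (hTS : ∀ x, T (shift p x) = shift m (T x))
    {θ : ES q → l2 p} (hθ : ∀ w, T (θ w) = 0)
    (hin : ∀ w w', inner ℂ (θ w') (θ w) = inner ℂ w' w)
    (horth : ∀ w k, T k = 0 → inner ℂ (shift p k) (θ w) = 0)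
    {v : ℕ → ES q} (hv : Summable fun k => ‖v k‖) :
    ∃ D : l2 p, T D = 0 ∧ (∀ n, D n = ∑ k ∈ Finset.range (n + 1), θ (v k) (n - k)) ∧
      ‖D‖ ^ 2 = ∑' k, ‖v k‖ ^ 2 := by
  have hnorm (w : ES q) : ‖θ w‖ = ‖w‖ := by
    rw [norm_eq_sqrt_re_inner (𝕜 := ℂ), hin, ← norm_eq_sqrt_re_inner]
  have hlt {j k : ℕ} (hjk : k < j) :
      inner ℂ ((shift p)^[j] (θ (v j))) ((shift p)^[k] (θ (v k))) = 0 := by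
    obtain ⟨d, rfl⟩ := Nat.exists_eq_add_of_lt hjk
    rw [add_assoc, Function.iterate_add_apply, inner_shift_iterate, Function.iterate_succ_apply']
    exact horth _ _ (toeplitz_shift_iterate hTS (hθ _) _)
  have hne {j k : ℕ} (hjk : j ≠ k) :
      inner ℂ ((shift p)^[j] (θ (v j))) ((shift p)^[k] (θ (v k))) = 0 := by
    rcases lt_or_gt_of_ne hjk with h | h
    · rw [← inner_conj_symm, hlt h, map_zero]
    · exact hlt h
  have hs : Summable fun k => (shift p)^[k] (θ (v k)) :=
    Summable.of_norm (by simpa only [norm_shift_iterate, hnorm] using hv)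
  obtain ⟨D, hD⟩ := hs
  refine ⟨D, ?_, fun n => ?_, ?_⟩
  · refine (hD.mapL T).unique ?_
    simpa only [toeplitz_shift_iterate hTS (hθ _)] using hasSum_zero
  · have h1 := hD.mapL (lp.evalCLM ℂ (fun _ : ℕ => ES p) 2 n)
    refine h1.unique ?_
    have h2 : ∑ k ∈ Finset.range (n + 1), θ (v k) (n - k)
        = ∑ k ∈ Finset.range (n + 1), ((shift p)^[k] (θ (v k))) n :=
      Finset.sum_congr rfl fun k hk => by
        rw [shift_iterate_apply, if_pos (Nat.lt_succ_iff.1 (Finset.mem_range.1 hk))]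
    rw [h2]
    refine hasSum_sum_of_ne_finset_zero fun k hk => ?_
    change ((shift p)^[k] (θ (v k))) n = 0
    rw [shift_iterate_apply, if_neg (by simpa using hk)]
  · have hj (k : ℕ) : inner ℂ ((shift p)^[k] (θ (v k))) D = ((‖v k‖ ^ 2 : ℝ) : ℂ) := by
      refine (hD.mapL (innerSL ℂ ((shift p)^[k] (θ (v k))))).unique ?_
      have h3 := hasSum_single (f := fun j =>
        inner ℂ ((shift p)^[k] (θ (v k))) ((shift p)^[j] (θ (v j)))) k fun j hj => hne hj.symm
      rw [inner_shift_iterate, hin, inner_self_eq_norm_sq_to_K] at h3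
      simpa using h3
    have hj' (k : ℕ) : inner ℂ D ((shift p)^[k] (θ (v k))) = ((‖v k‖ ^ 2 : ℝ) : ℂ) := by
      rw [← inner_conj_symm, hj, Complex.conj_ofReal]
    have h4 : HasSum (fun k => inner ℂ D ((shift p)^[k] (θ (v k)))) (inner ℂ D D) :=
      hD.mapL (innerSL ℂ D)
    have h5 : HasSum (fun k => ((‖v k‖ ^ 2 : ℝ) : ℂ)) ((‖D‖ ^ 2 : ℝ) : ℂ) := by
      simpa only [hj', inner_self_eq_norm_sq_to_K, Complex.ofReal_pow, Complex.coe_algebraMap]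
        using h4
    exact (Complex.hasSum_ofReal.1 h5).tsum_eq.symm

end Operators

section Coefficients

theorem inner_single_right {n : ℕ} (k : ℕ) (e : ES n) (x : l2 n) :
    inner ℂ x (lp.single 2 k e : l2 n) = inner ℂ (x k : ES n) (e : ES n) :=
  lp.inner_single_right (G := fun _ : ℕ => ES n) k e x

open Matrix (toEuclideanLin)

variable {r s t : ℕ}

theorem toEuclideanLin_mul_apply (A : Matrix (Fin r) (Fin s) ℂ) (B : Matrix (Fin s) (Fin t) ℂ)
    (x : ES t) : toEuclideanLin (A * B) x = toEuclideanLin A (toEuclideanLin B x) := by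
  simp [Matrix.toLpLin_apply, Matrix.mulVec_mulVec]

theorem toEuclideanLin_eVec_apply (A : Matrix (Fin r) (Fin s) ℂ) (a : Fin r) (b : Fin s) :
    toEuclideanLin A (eVec s b) a = A a b := by
  simp [Matrix.toLpLin_apply]

theorem toEuclideanLin_cauchyMul (F : ℕ → Matrix (Fin r) (Fin s) ℂ)
    (K : ℕ → Matrix (Fin s) (Fin t) ℂ) (n : ℕ) (x : ES t) :
    toEuclideanLin (cauchyMul F K n) x = ∑ ij ∈ Finset.HasAntidiagonal.antidiagonal n,
      toEuclideanLin (F ij.1) (toEuclideanLin (K ij.2) x) := by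
  simp only [cauchyMul, map_sum, LinearMap.sum_apply, toEuclideanLin_mul_apply]

theorem tsum_sum_norm_mulVec_sq (F : ℕ → Matrix (Fin r) (Fin s) ℂ) (u : Fin s → ℂ) :
    ∑' ν, ∑ a, ‖(F ν).mulVec u a‖ ^ 2
      = ∑' ν, ‖toEuclideanLin (F ν) (WithLp.toLp 2 u)‖ ^ 2 := by
  simp only [EuclideanSpace.norm_sq_eq, Matrix.toLpLin_apply]

theorem tsum_sum_norm_mulVec_sq_eq (F : ℕ → Matrix (Fin r) (Fin s) ℂ) (u : Fin s → ℂ)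
    (x : l2 r) (hx : ∀ ν, x ν = toEuclideanLin (F ν) (WithLp.toLp 2 u)) :
    ∑' ν, ∑ a, ‖(F ν).mulVec u a‖ ^ 2 = ‖x‖ ^ 2 := by
  rw [tsum_sum_norm_mulVec_sq, ← (hasSum_norm_sq x).tsum_eq]
  simp only [hx]

theorem IsWiener.summable_norm_toEuclideanLin {F : ℕ → Matrix (Fin r) (Fin s) ℂ}
    (hF : IsWiener F) (x : ES s) : Summable fun ν => ‖toEuclideanLin (F ν) x‖ := by
  have hx : x = ∑ b, x b • eVec s b := by
    simpa using ((EuclideanSpace.basisFun (Fin s) ℂ).sum_repr x).symm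
  have hcol (b : Fin s) : Summable fun ν => ‖toEuclideanLin (F ν) (eVec s b)‖ := by
    refine Summable.of_nonneg_of_le (fun _ => norm_nonneg _) (fun ν => ?_)
      (summable_sum fun a (_ : a ∈ Finset.univ) => hF a b)
    have h := (EuclideanSpace.basisFun (Fin r) ℂ).sum_repr (toEuclideanLin (F ν) (eVec s b))
    rw [← h]
    refine (norm_sum_le _ _).trans (Finset.sum_le_sum fun a _ => ?_)
    rw [norm_smul, OrthonormalBasis.norm_eq_one, mul_one, EuclideanSpace.basisFun_repr,
      toEuclideanLin_eVec_apply]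
  refine Summable.of_nonneg_of_le (fun _ => norm_nonneg _) (fun ν => ?_)
    (summable_sum fun b (_ : b ∈ Finset.univ) => (hcol b).mul_left ‖x b‖)
  conv_lhs => rw [hx, map_sum]
  refine (norm_sum_le _ _).trans_eq ?_
  simp only [map_smul, norm_smul]

/-- The square summable sequence of coefficients of `F(·)u`, for `F` in the Wiener class. -/
theorem IsWiener.exists_l2 {F : ℕ → Matrix (Fin r) (Fin s) ℂ} (hF : IsWiener F) (u : ES s) :
    ∃ x : l2 r, ∀ ν, x ν = toEuclideanLin (F ν) u := by
  have h1 : Memℓp (fun ν => toEuclideanLin (F ν) u) 1 :=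
    memℓp_gen (by simpa using hF.summable_norm_toEuclideanLin u)
  exact ⟨⟨_, h1.of_exponent_ge (by norm_num)⟩, fun _ => rfl⟩

theorem apply_single_zero_eq_toEuclideanLin (f : l2 s →L[ℂ] l2 r) (M : Matrix (Fin r) (Fin s) ℂ)
    (ν : ℕ) (h : ∀ a b, M a b = f (lp.single 2 0 (eVec s b)) ν a) (x : ES s) :
    f (lp.single 2 0 x) ν = toEuclideanLin M x := by
  let g : l2 s →L[ℂ] ES r := (lp.evalCLM ℂ (fun _ : ℕ => ES r) 2 ν).comp f
  have hg : (g.comp (lp.singleContinuousLinearMap ℂ (fun _ : ℕ => ES s) 2 0)).toLinearMap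
      = toEuclideanLin M := by
    refine (EuclideanSpace.basisFun (Fin s) ℂ).toBasis.ext fun b => ?_
    ext a
    rw [OrthonormalBasis.coe_toBasis, EuclideanSpace.basisFun_apply, toEuclideanLin_eVec_apply, h]
    rfl
  exact LinearMap.congr_fun hg x

variable {T H : l2 s →L[ℂ] l2 r} {G : ℕ → Matrix (Fin r) (Fin s) ℂ}

theorem toeplitz_shift
    (hT : ∀ (j : ℕ) (b : Fin s) (i : ℕ) (a : Fin r),
      (T (lp.single 2 j (eVec s b))) i a = if j ≤ i then G (i - j) a b else 0) (x : l2 s) :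
    T (shift s x) = shift r (T x) := by
  have h : T.comp (shift s).toContinuousLinearMap = (shift r).toContinuousLinearMap.comp T := by
    refine clm_ext_of_single fun j b => ?_
    change T (shift s _) = shift r (T _)
    rw [shift_single]
    ext i a
    cases i with
    | zero => rw [hT]; simp
    | succ i => rw [hT, shift_apply_succ, hT]; simp
  exact DFunLike.congr_fun h x

theorem bshift_toeplitz_single
    (hT : ∀ (j : ℕ) (b : Fin s) (i : ℕ) (a : Fin r),
      (T (lp.single 2 j (eVec s b))) i a = if j ≤ i then G (i - j) a b else 0)
    (hH : ∀ (j : ℕ) (b : Fin s) (i : ℕ) (a : Fin r),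
      (H (lp.single 2 j (eVec s b))) i a = G (i + j + 1) a b) (x : ES s) :
    bshift r (T (lp.single 2 0 x)) = H (lp.single 2 0 x) := by
  ext i : 2
  rw [bshift_apply, apply_single_zero_eq_toEuclideanLin T (G (i + 1)) (i + 1),
    apply_single_zero_eq_toEuclideanLin H (G (i + 1)) i]
  · intro a b
    rw [hH, add_zero]
  · intro a b
    rw [hT]
    simp

theorem toeplitz_apply
    (hT : ∀ (j : ℕ) (b : Fin s) (i : ℕ) (a : Fin r),
      (T (lp.single 2 j (eVec s b))) i a = if j ≤ i then G (i - j) a b else 0)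
    (x : l2 s) (n : ℕ) :
    T x n = ∑ ij ∈ Finset.HasAntidiagonal.antidiagonal n, toEuclideanLin (G ij.1) (x ij.2) := by
  let g : l2 s →L[ℂ] ES r := (lp.evalCLM ℂ (fun _ : ℕ => ES r) 2 n).comp T
  let g' : l2 s →L[ℂ] ES r := ∑ ij ∈ Finset.HasAntidiagonal.antidiagonal n,
    (toEuclideanLin (G ij.1)).toContinuousLinearMap.comp
      (lp.evalCLM ℂ (fun _ : ℕ => ES s) 2 ij.2)
  have hg' (y : l2 s) : g' y
      = ∑ ij ∈ Finset.HasAntidiagonal.antidiagonal n, toEuclideanLin (G ij.1) (y ij.2) := by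
    simp only [g', sum_apply]
    rfl
  have h : g = g' := by
    refine clm_ext_of_single fun j b => ?_
    rw [hg']
    ext a
    change T (lp.single 2 j (eVec s b)) n a = _
    rw [hT]
    split_ifs with hj
    · rw [Finset.sum_eq_single (n - j, j)]
      · rw [lp.single_apply_self, toEuclideanLin_eVec_apply]
      · rintro ⟨k, l⟩ hkl hne
        have hl : l ≠ j := by
          rintro rfl
          have := Finset.HasAntidiagonal.mem_antidiagonal.1 hkl
          exact hne (by simp; omega)
        rw [lp.single_apply_ne _ _ _ hl, map_zero]
      · intro hn
        exact absurd (Finset.HasAntidiagonal.mem_antidiagonal.2 (by simp; omega)) hn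
    · rw [Finset.sum_eq_zero]
      · rfl
      · rintro ⟨k, l⟩ hkl
        have := Finset.HasAntidiagonal.mem_antidiagonal.1 hkl
        have hl : l ≠ j := by
          rintro rfl
          simp only at this
          omega
        rw [lp.single_apply_ne _ _ _ hl, map_zero]
  rw [← hg', ← h]
  rfl

theorem inner_toEuclideanLin_left (A : Matrix (Fin r) (Fin s) ℂ) (x : ES s) (y : ES r) :
    inner ℂ (toEuclideanLin A x) y = inner ℂ x (toEuclideanLin Aᴴ y) := by
  rw [Matrix.toEuclideanLin_conjTranspose_eq_adjoint, LinearMap.adjoint_inner_right]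

theorem exists_toEuclideanLin_conjTranspose_eq {A : Matrix (Fin r) (Fin s) ℂ}
    (hA : ∀ w, A.mulVec w = 0 → w = 0) (w : ES s) : ∃ x : ES r, toEuclideanLin Aᴴ x = w := by
  have hU : IsUnit (Aᴴ * A) := by
    rw [← Matrix.mulVec_injective_iff_isUnit]
    refine (injective_iff_map_eq_zero (Aᴴ * A).mulVecLin).2 fun v hv => hA v ?_
    open scoped ComplexOrder in exact (Matrix.conjTranspose_mul_self_mulVec_eq_zero A v).1 hv
  refine ⟨toEuclideanLin A (toEuclideanLin (Aᴴ * A)⁻¹ w), ?_⟩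
  rw [← toEuclideanLin_mul_apply, ← toEuclideanLin_mul_apply,
    Matrix.mul_nonsing_inv _ ((Matrix.isUnit_iff_isUnit_det _).1 hU)]
  simp

end Coefficients

section Parametrization

open Matrix (toEuclideanLin)

variable {m p : ℕ} {T H : l2 p →L[ℂ] l2 m} {R : l2 m →L[ℂ] l2 m}

theorem yCol_apply {Yc : ℕ → Matrix (Fin p) (Fin p) ℂ} (hYc0 : Yc 0 = 1)
    (hYc : ∀ (ν : ℕ) (a b : Fin p),
      Yc (ν + 1) a b = -(T.adjoint (R (H (lp.single 2 0 (eVec p b))))) ν a)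
    (x : ES p) (ν : ℕ) : yCol T H R x ν = toEuclideanLin (Yc ν) x := by
  rw [yCol, lp.coeFn_sub, Pi.sub_apply]
  cases ν with
  | zero => simp [hYc0]
  | succ ν =>
    rw [shift_apply_succ, lp.single_apply_ne _ _ _ ν.succ_ne_zero, zero_sub]
    exact apply_single_zero_eq_toEuclideanLin (-(T.adjoint.comp (R.comp H))) (Yc (ν + 1)) ν
      (hYc ν) x

/-- The columns of `Y(·)Θ₀` lie in `ker T`, and `Y(·)Θ₀` is inner. -/
theorem yCol_inner {q : ℕ} {Θ₀ : Matrix (Fin p) (Fin q) ℂ}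
    (hTS : ∀ x, T (shift p x) = shift m (T x))
    (hTH : ∀ x, bshift m (T (lp.single 2 0 x)) = H (lp.single 2 0 x))
    (hR1 : ∀ x, R (T (T.adjoint x)) = x) (hR2 : ∀ x, T (T.adjoint (R x)) = x)
    (hker : ∀ w, Θ₀.mulVec w = 0 → w = 0)
    (hΘ : ∀ a b, (Θ₀ * Θ₀ᴴ) a b
      = (if a = b then 1 else 0) - (T.adjoint (R (T (lp.single 2 0 (eVec p b))))) 0 a)
    (h0 : ∀ x, yCol T H R x 0 = x) :
    (∀ w, T (yCol T H R (toEuclideanLin Θ₀ w)) = 0) ∧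
    (∀ w w', inner ℂ (yCol T H R (toEuclideanLin Θ₀ w')) (yCol T H R (toEuclideanLin Θ₀ w))
      = inner ℂ w' w) ∧
    (∀ w k, T k = 0 → inner ℂ (shift p k) (yCol T H R (toEuclideanLin Θ₀ w)) = 0) := by
  have hΘx (x : ES p) : toEuclideanLin Θ₀ (toEuclideanLin Θ₀ᴴ x)
      = x - (T.adjoint (R (T (lp.single 2 0 x)))) 0 := by
    rw [← toEuclideanLin_mul_apply]
    have h := apply_single_zero_eq_toEuclideanLin
      (ContinuousLinearMap.id ℂ (l2 p) - T.adjoint.comp (R.comp T)) (Θ₀ * Θ₀ᴴ) 0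
      (fun a b => by
        rw [hΘ]
        simp) x
    rw [← h]
    simp
  have hcol (w : ES q) : ∃ x, toEuclideanLin Θ₀ᴴ x = w ∧ yCol T H R (toEuclideanLin Θ₀ w)
      = lp.single 2 0 x - T.adjoint (R (T (lp.single 2 0 x))) := by
    obtain ⟨x, rfl⟩ := exists_toEuclideanLin_conjTranspose_eq hker w
    exact ⟨x, rfl, by rw [single_sub_proj_eq_yCol hTS hTH hR1 hR2, hΘx]⟩
  have hT (w : ES q) : T (yCol T H R (toEuclideanLin Θ₀ w)) = 0 := by
    obtain ⟨x, -, hx⟩ := hcol w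
    rw [hx, map_sub, hR2, sub_self]
  have hinner (k : l2 p) (hk : T k = 0) (x : ES p) :
      inner ℂ k (lp.single 2 0 x - T.adjoint (R (T (lp.single 2 0 x))))
        = inner ℂ (k 0 : ES p) x := by
    rw [inner_sub_right, inner_single_right, ContinuousLinearMap.adjoint_inner_right, hk,
      inner_zero_left, sub_zero]
  refine ⟨hT, fun w w' => ?_, fun w k hk => ?_⟩
  · obtain ⟨x, hx, hwx⟩ := hcol w
    rw [hwx, hinner _ (hT w'), h0, inner_toEuclideanLin_left, hx]
  · obtain ⟨x, -, hwx⟩ := hcol w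
    rw [hwx, hinner _ (by rw [hTS, hk, map_zero]), shift_apply_zero, inner_zero_left]

theorem norm_adjoint_add_sq {x : l2 p} {y : l2 m} (hx : T x = 0) :
    ‖T.adjoint y + x‖ ^ 2 = ‖T.adjoint y‖ ^ 2 + ‖x‖ ^ 2 := by
  rw [norm_add_sq (𝕜 := ℂ), ContinuousLinearMap.adjoint_inner_left, hx]
  simp

theorem isWiener_one {n : ℕ} :
    IsWiener fun ν => if ν = 0 then (1 : Matrix (Fin n) (Fin n) ℂ) else 0 := fun a b =>
  summable_of_ne_finset_zero (s := {0}) fun ν hν => by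
    have hν0 : ν ≠ 0 := by simpa using hν
    simp [hν0]

theorem seriesM_one {n : ℕ} (z : ℂ) :
    seriesM (fun ν => if ν = 0 then (1 : Matrix (Fin n) (Fin n) ℂ) else 0) z = 1 := by
  ext a b
  rw [seriesM, Matrix.of_apply, tsum_eq_single 0 fun ν hν => by simp [hν]]
  simp

end Parametrization

/-- For `G ∈ W₊^{m×p}` with `T_G T_G*` strictly positive: for a Wiener
parameter `V` and `X(z) = Y(z)Ξ₀ + Y(z)Θ₀V(z)`, the `H²` identity
`‖X(·)u‖² = ‖Y(·)Ξ₀u‖² + ‖V(·)u‖²` holds for every `u ∈ ℂᵐ`; in particular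
`Ξ(z) = Y(z)Ξ₀` is the least squares Wiener solution of the Bezout problem. -/
theorem bezout_corona_stmt14
    (m p : ℕ) (hm : 0 < m) (hmp : m ≤ p)
    (G : ℕ → Matrix (Fin m) (Fin p) ℂ)
    (hGW : ∀ (a : Fin m) (b : Fin p), Summable fun ν => ‖G ν a b‖)
    (TG : l2 p →L[ℂ] l2 m)
    (hTG : ∀ (j : ℕ) (b : Fin p) (i : ℕ) (a : Fin m),
      (TG (lp.single 2 j (eVec p b))) i a = if j ≤ i then G (i - j) a b else 0)
    (HG : l2 p →L[ℂ] l2 m)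
    (hHG : ∀ (j : ℕ) (b : Fin p) (i : ℕ) (a : Fin m),
      (HG (lp.single 2 j (eVec p b))) i a = G (i + j + 1) a b)
    (Tinv : l2 m →L[ℂ] l2 m)
    (hT1 : ∀ x, Tinv (TG (TG.adjoint x)) = x)
    (hT2 : ∀ x, TG (TG.adjoint (Tinv x)) = x)
    (Ξ₀ : Matrix (Fin p) (Fin m) ℂ)
    (hΞ₀ : ∀ (a : Fin p) (b : Fin m),
      Ξ₀ a b = (TG.adjoint (Tinv (lp.single 2 0 (eVec m b)))) 0 a)
    (Θ₀ : Matrix (Fin p) (Fin (p - m)) ℂ)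
    (hΘ₀ker : ∀ w : Fin (p - m) → ℂ, Θ₀.mulVec w = 0 → w = 0)
    (hΘ₀ : ∀ (a b : Fin p), (Θ₀ * Θ₀ᴴ) a b
      = (if a = b then 1 else 0) - (TG.adjoint (Tinv (TG (lp.single 2 0 (eVec p b))))) 0 a)
    (Yc : ℕ → Matrix (Fin p) (Fin p) ℂ)
    (hYc0 : Yc 0 = 1)
    (hYc : ∀ (ν : ℕ) (a b : Fin p),
      Yc (ν + 1) a b = -(TG.adjoint (Tinv (HG (lp.single 2 0 (eVec p b))))) ν a)
    (hYcW : ∀ a b, Summable fun ν => ‖Yc ν a b‖) :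
    (∀ Vc : ℕ → Matrix (Fin (p - m)) (Fin m) ℂ,
      (∀ a b, Summable fun ν => ‖Vc ν a b‖) →
      ∀ Xc : ℕ → Matrix (Fin p) (Fin m) ℂ,
      (∀ a b, Summable fun ν => ‖Xc ν a b‖) →
      (∀ z ∈ Metric.ball (0 : ℂ) 1,
        seriesM Xc z = seriesM Yc z * Ξ₀ + seriesM Yc z * Θ₀ * seriesM Vc z) →
      ∀ u : Fin m → ℂ,
        (∑' ν : ℕ, ∑ a, ‖(Xc ν).mulVec u a‖ ^ 2)
          = (∑' ν : ℕ, ∑ a, ‖(Yc ν * Ξ₀).mulVec u a‖ ^ 2)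
            + ∑' ν : ℕ, ∑ a, ‖(Vc ν).mulVec u a‖ ^ 2) ∧
    (∀ Xc : ℕ → Matrix (Fin p) (Fin m) ℂ,
      (∀ a b, Summable fun ν => ‖Xc ν a b‖) →
      (∀ z ∈ Metric.ball (0 : ℂ) 1, seriesM G z * seriesM Xc z = 1) →
      ∀ u : Fin m → ℂ,
        (∑' ν : ℕ, ∑ a, ‖(Yc ν * Ξ₀).mulVec u a‖ ^ 2)
          ≤ ∑' ν : ℕ, ∑ a, ‖(Xc ν).mulVec u a‖ ^ 2) := by
  have hTS := toeplitz_shift hTG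
  have hTH := bshift_toeplitz_single hTG hHG
  have hY := yCol_apply hYc0 hYc
  have hξ (u : Fin m → ℂ) (ν : ℕ) :
      TG.adjoint (Tinv (lp.single 2 0 (WithLp.toLp 2 u))) ν
        = Matrix.toEuclideanLin (Yc ν * Ξ₀) (WithLp.toLp 2 u) := by
    rw [rightInverse_single_eq_yCol hTS hTH hT1 hT2, hY, toEuclideanLin_mul_apply]
    congr 1
    exact apply_single_zero_eq_toEuclideanLin (TG.adjoint.comp Tinv) Ξ₀ 0 hΞ₀ _
  refine ⟨fun Vc hV Xc hX hXV u => ?_, fun Xc hX hGX u => ?_⟩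
  · have hYΘ : IsWiener fun ν => Yc ν * Θ₀ := IsWiener.mul_const hYcW Θ₀
    have hYΞ : IsWiener fun ν => Yc ν * Ξ₀ := IsWiener.mul_const hYcW Ξ₀
    have hconv : IsWiener (cauchyMul (fun ν => Yc ν * Θ₀) Vc) := hYΘ.cauchyMul hV
    have hXc : Xc = fun ν => Yc ν * Ξ₀ + cauchyMul (fun ν => Yc ν * Θ₀) Vc ν := by
      refine IsWiener.eq_of_seriesM_eq hX (hYΞ.add hconv) fun z hz => ?_
      rw [hXV z hz, hYΞ.seriesM_add hconv hz, hYΘ.seriesM_cauchyMul hV hz,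
        IsWiener.seriesM_mul_const hYcW _ hz, IsWiener.seriesM_mul_const hYcW _ hz]
    obtain ⟨hθ, hin, horth⟩ := yCol_inner hTS hTH hT1 hT2 hΘ₀ker hΘ₀
      fun x => by simpa [hYc0] using hY x 0
    obtain ⟨D, hTD, hD, hDn⟩ := exists_conv_of_inner hTS hθ hin horth
      (IsWiener.summable_norm_toEuclideanLin hV (WithLp.toLp 2 u))
    have hadd : ∀ ν, (TG.adjoint (Tinv (lp.single 2 0 (WithLp.toLp 2 u))) + D) ν
        = Matrix.toEuclideanLin (Xc ν) (WithLp.toLp 2 u) := by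
      intro ν
      rw [lp.coeFn_add, Pi.add_apply, hξ, hD, hXc, map_add, LinearMap.add_apply,
        toEuclideanLin_cauchyMul, ← Finset.Nat.sum_antidiagonal_swap,
        Finset.Nat.sum_antidiagonal_eq_sum_range_succ_mk]
      simp only [hY, toEuclideanLin_mul_apply, Prod.swap_prod_mk]
    rw [tsum_sum_norm_mulVec_sq_eq Xc u _ hadd,
      tsum_sum_norm_mulVec_sq_eq (fun ν => Yc ν * Ξ₀) u _ (hξ u), tsum_sum_norm_mulVec_sq,
      norm_adjoint_add_sq hTD, hDn]
  · obtain ⟨x, hx⟩ := IsWiener.exists_l2 hX (WithLp.toLp 2 u)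
    have hcoef : cauchyMul G Xc = fun ν => if ν = 0 then 1 else 0 :=
      IsWiener.eq_of_seriesM_eq (IsWiener.cauchyMul hGW hX) isWiener_one fun z hz => by
        rw [IsWiener.seriesM_cauchyMul hGW hX hz, hGX z hz, seriesM_one]
    have hTx : TG x = lp.single 2 0 (WithLp.toLp 2 u : ES m) := by
      ext ν : 2
      rw [toeplitz_apply hTG]
      simp only [hx]
      rw [← toEuclideanLin_cauchyMul, hcoef]
      cases ν <;> simp [lp.single_apply]
    have hker : TG (x - TG.adjoint (Tinv (lp.single 2 0 (WithLp.toLp 2 u)))) = 0 := by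
      rw [map_sub, hTx, hT2, sub_self]
    have hsq := norm_adjoint_add_sq (y := Tinv (lp.single 2 0 (WithLp.toLp 2 u : ES m))) hker
    rw [add_sub_cancel] at hsq
    rw [tsum_sum_norm_mulVec_sq_eq Xc u x hx,
      tsum_sum_norm_mulVec_sq_eq (fun ν => Yc ν * Ξ₀) u _ (hξ u), hsq]
    exact le_add_of_nonneg_right (sq_nonneg _)
end
end

section
/- Let G ∈ H^∞_{m×p} with T_G T_G* strictly positive. Then the function Y and the function z ↦ Y(z)⁻¹ both belong to H²_{p×p}; that is, the Taylor coefficient sequences of Y and of Y(·)⁻¹ are square-summable in norm. -/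
/-!
Setting: `l2 n` models ℓ²₊(ℂⁿ); `lp.single 2 0` is the canonical embedding `E_n`, and
evaluating a sequence at coordinate `k` realizes `E_n* (S_n*)^k`.  Block Toeplitz and
Hankel operators, as well as the (bounded) inverse of `T_G T_G*`, are specified through
their actions on the standard basis vectors of the coordinate spaces.
-/

noncomputable section
open scoped Matrix

/-- The `b`-th entry of the `j`-th coordinate is the inner product with a basis vector. -/
lemma inner_single_eVec {n : ℕ} (j : ℕ) (b : Fin n) (x : l2 n) :
    inner ℂ (lp.single 2 j (eVec n b) : l2 n) x = x j b := by
  rw [lp.inner_single_left]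
  simp [EuclideanSpace.inner_single_left]

lemma summable_entry_sq {n : ℕ} (x : l2 n) (a : Fin n) :
    Summable fun ν => ‖x ν a‖ ^ 2 := by
  have h : Summable fun ν => ‖x ν‖ ^ 2 := by
    simpa using (lp.memℓp x).summable (by norm_num)
  refine h.of_nonneg_of_le (fun _ => by positivity) fun ν => ?_
  gcongr
  exact PiLp.norm_apply_le (x ν) a

lemma memℓp_succ {n : ℕ} (x : l2 n) : Memℓp (fun i => x (i + 1)) 2 := by
  refine memℓp_gen ?_
  exact (summable_nat_add_iff 1).2 ((lp.memℓp x).summable (by norm_num))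

/-- The backward shift on `ℓ²₊(ℂⁿ)`. -/
def backwardShift (n : ℕ) : l2 n →L[ℂ] l2 n :=
  LinearMap.mkContinuous
    { toFun := fun x => ⟨fun i => x (i + 1), memℓp_succ x⟩
      map_add' := fun _ _ => rfl
      map_smul' := fun _ _ => rfl } 1 <| by
    intro x
    rw [one_mul]
    refine lp.norm_le_of_tsum_le (by norm_num) (norm_nonneg _) ?_
    rw [lp.norm_rpow_eq_tsum (by norm_num) x]
    have hs := (lp.memℓp x).summable (by norm_num)
    rw [hs.tsum_eq_zero_add]
    exact le_add_of_nonneg_left (by positivity)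

@[simp]
lemma backwardShift_apply {n : ℕ} (x : l2 n) (i : ℕ) :
    backwardShift n x i = x (i + 1) := rfl

lemma backwardShift_single_zero {n : ℕ} (v : ES n) :
    backwardShift n (lp.single 2 0 v) = 0 := by
  ext i : 2
  simp [lp.single_apply]

lemma backwardShift_single_succ {n : ℕ} (j : ℕ) (v : ES n) :
    backwardShift n (lp.single 2 (j + 1) v) = lp.single 2 j v := by
  ext i : 2
  by_cases h : i = j
  · subst h; simp
  · simp [lp.single_apply, h]

lemma inner_backwardShift {n : ℕ} (x y : l2 n) (h0 : y 0 = 0) :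
    inner ℂ (backwardShift n y) (backwardShift n x) = inner ℂ y x := by
  have h := (lp.summable_inner (𝕜 := ℂ) y x).tsum_eq_zero_add
  rw [h0, inner_zero_left, zero_add] at h
  rw [lp.inner_eq_tsum, lp.inner_eq_tsum, h]
  simp only [backwardShift_apply]

/-- Bounded operators on `ℓ²₊(ℂⁿ)` agree when they agree on the standard basis. -/
lemma clm_ext_single {n : ℕ} {F : Type*} [NormedAddCommGroup F] [NormedSpace ℂ F]
    {L M : l2 n →L[ℂ] F}
    (h : ∀ j b, L (lp.single 2 j (eVec n b)) = M (lp.single 2 j (eVec n b))) : L = M := by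
  have hv : ∀ j (v : ES n), L (lp.single 2 j v) = M (lp.single 2 j v) := by
    intro j v
    have hb := (EuclideanSpace.basisFun (Fin n) ℂ).toBasis.ext
      (f₁ := L.toLinearMap ∘ₗ lp.lsingle (𝕜 := ℂ) (E := fun _ : ℕ => ES n) 2 j)
      (f₂ := M.toLinearMap ∘ₗ lp.lsingle (𝕜 := ℂ) (E := fun _ : ℕ => ES n) 2 j)
      (fun b => by simpa using h j b)
    exact LinearMap.congr_fun hb v
  ext x
  have hx := lp.hasSum_single (p := 2) (by norm_num) x
  have hL := L.hasSum hx
  simp_rw [hv] at hL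
  exact hL.unique (M.hasSum hx)

section Toeplitz

variable {m p : ℕ} {G : ℕ → Matrix (Fin m) (Fin p) ℂ} {TG HG : l2 p →L[ℂ] l2 m}

lemma toeplitz_single_succ_zero
    (hTG : ∀ (j : ℕ) (b : Fin p) (i : ℕ) (a : Fin m),
      (TG (lp.single 2 j (eVec p b))) i a = if j ≤ i then G (i - j) a b else 0)
    (j : ℕ) (b : Fin p) : TG (lp.single 2 (j + 1) (eVec p b)) 0 = 0 := by
  ext a
  simp [hTG]

lemma backwardShift_toeplitz_single_succ
    (hTG : ∀ (j : ℕ) (b : Fin p) (i : ℕ) (a : Fin m),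
      (TG (lp.single 2 j (eVec p b))) i a = if j ≤ i then G (i - j) a b else 0)
    (j : ℕ) (b : Fin p) :
    backwardShift m (TG (lp.single 2 (j + 1) (eVec p b))) = TG (lp.single 2 j (eVec p b)) := by
  ext i a
  simp [hTG]

lemma backwardShift_toeplitz_single_zero
    (hTG : ∀ (j : ℕ) (b : Fin p) (i : ℕ) (a : Fin m),
      (TG (lp.single 2 j (eVec p b))) i a = if j ≤ i then G (i - j) a b else 0)
    (hHG : ∀ (j : ℕ) (b : Fin p) (i : ℕ) (a : Fin m),
      (HG (lp.single 2 j (eVec p b))) i a = G (i + j + 1) a b) (b : Fin p) :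
    backwardShift m (TG (lp.single 2 0 (eVec p b))) = HG (lp.single 2 0 (eVec p b)) := by
  ext i a
  simp [hTG, hHG]

lemma backwardShift_hankel_single
    (hHG : ∀ (j : ℕ) (b : Fin p) (i : ℕ) (a : Fin m),
      (HG (lp.single 2 j (eVec p b))) i a = G (i + j + 1) a b) (j : ℕ) (b : Fin p) :
    backwardShift m (HG (lp.single 2 j (eVec p b))) = HG (lp.single 2 (j + 1) (eVec p b)) := by
  ext i a
  simp [hHG, add_right_comm, ← add_assoc]

lemma backwardShift_adjoint_toeplitz
    (hTG : ∀ (j : ℕ) (b : Fin p) (i : ℕ) (a : Fin m),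
      (TG (lp.single 2 j (eVec p b))) i a = if j ≤ i then G (i - j) a b else 0) (x : l2 m) :
    backwardShift p (TG.adjoint x) = TG.adjoint (backwardShift m x) := by
  ext k b
  rw [backwardShift_apply, ← inner_single_eVec, ← inner_single_eVec,
    ContinuousLinearMap.adjoint_inner_right, ContinuousLinearMap.adjoint_inner_right]
  rw [← backwardShift_toeplitz_single_succ hTG k,
    inner_backwardShift _ _ (toeplitz_single_succ_zero hTG k b)]

lemma backwardShift_toeplitz
    (hTG : ∀ (j : ℕ) (b : Fin p) (i : ℕ) (a : Fin m),
      (TG (lp.single 2 j (eVec p b))) i a = if j ≤ i then G (i - j) a b else 0)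
    (hHG : ∀ (j : ℕ) (b : Fin p) (i : ℕ) (a : Fin m),
      (HG (lp.single 2 j (eVec p b))) i a = G (i + j + 1) a b) (x : l2 p) :
    backwardShift m (TG x) =
      TG (backwardShift p x) + ∑ c, x 0 c • HG (lp.single 2 0 (eVec p c)) := by
  have key : (backwardShift m).comp TG = TG.comp (backwardShift p) +
      ∑ c, (innerSL ℂ (lp.single 2 0 (eVec p c) : l2 p)).smulRight
        (HG (lp.single 2 0 (eVec p c))) := by
    refine clm_ext_single fun j b => ?_
    simp only [ContinuousLinearMap.comp_apply, add_apply,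
      sum_apply, ContinuousLinearMap.smulRight_apply, innerSL_apply_apply,
      inner_single_eVec]
    cases j with
    | zero =>
      rw [backwardShift_toeplitz_single_zero hTG hHG, backwardShift_single_zero, map_zero, zero_add]
      simp [lp.single_apply, ite_smul]
    | succ j =>
      rw [backwardShift_toeplitz_single_succ hTG, backwardShift_single_succ]
      simp [lp.single_apply]
  have := DFunLike.congr_fun key x
  simpa only [ContinuousLinearMap.comp_apply, add_apply,
    sum_apply, ContinuousLinearMap.smulRight_apply, innerSL_apply_apply,
    inner_single_eVec] using this

/-- The state vectors `T_G* (T_G T_G*)⁻¹ H_G` applied to basis vectors satisfy a shift recursion. -/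
lemma state_succ
    (hTG : ∀ (j : ℕ) (b : Fin p) (i : ℕ) (a : Fin m),
      (TG (lp.single 2 j (eVec p b))) i a = if j ≤ i then G (i - j) a b else 0)
    (hHG : ∀ (j : ℕ) (b : Fin p) (i : ℕ) (a : Fin m),
      (HG (lp.single 2 j (eVec p b))) i a = G (i + j + 1) a b)
    {Tinv : l2 m →L[ℂ] l2 m}
    (hT1 : ∀ x, Tinv (TG (TG.adjoint x)) = x) (hT2 : ∀ x, TG (TG.adjoint (Tinv x)) = x)
    (N : ℕ) (b : Fin p) :
    TG.adjoint (Tinv (HG (lp.single 2 (N + 1) (eVec p b)))) =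
      backwardShift p (TG.adjoint (Tinv (HG (lp.single 2 N (eVec p b))))) +
      ∑ c, (TG.adjoint (Tinv (HG (lp.single 2 N (eVec p b))))) 0 c •
        TG.adjoint (Tinv (HG (lp.single 2 0 (eVec p c)))) := by
  have hinj : ∀ u w : l2 m, TG (TG.adjoint u) = TG (TG.adjoint w) → u = w := fun u w h => by
    rw [← hT1 u, h, hT1]
  simp only [backwardShift_adjoint_toeplitz hTG, ← map_smul, ← map_sum, ← map_add]
  congr 1
  apply hinj
  rw [hT2, map_add, map_add, hT2, ← backwardShift_adjoint_toeplitz hTG, map_sum]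
  simp only [map_smul]
  rw [← backwardShift_toeplitz hTG hHG, hT2, backwardShift_hankel_single hHG]

end Toeplitz

/-- Unrolling a state recursion into a discrete convolution. -/
lemma state_eq_convolution {p : ℕ} (v : ℕ → Fin p → l2 p)
    (hv : ∀ N b, v (N + 1) b = backwardShift p (v N b) + ∑ c, (v N b) 0 c • v 0 c)
    (N k : ℕ) (a b : Fin p) :
    (v N b) k a = (v 0 b) (N + k) a +
      ∑ j ∈ Finset.range N, ∑ c, (v 0 c) (N - 1 - j + k) a * (v j b) 0 c := by
  induction N generalizing k with
  | zero => simp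
  | succ N ih =>
    have hs : (∑ c, (v N b) 0 c • v 0 c : l2 p) k a =
        ∑ c, (v 0 c) k a * (v N b) 0 c := by
      rw [← inner_single_eVec, inner_sum]
      simp [inner_smul_right, inner_single_eVec, mul_comm]
    rw [hv, lp.coeFn_add, Pi.add_apply, PiLp.add_apply, hs, backwardShift_apply, ih,
      Finset.sum_range_succ, add_assoc]
    congr 1
    · rw [show N + (k + 1) = N + 1 + k by omega]
    · congr 1
      · refine Finset.sum_congr rfl fun j hj => ?_
        have hj := Finset.mem_range.1 hj
        rw [show N - 1 - j + (k + 1) = N + 1 - 1 - j + k by omega]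
      · simp

lemma summable_norm_pow_mul {f : ℕ → ℂ} (hf : Summable fun ν => ‖f ν‖ ^ 2) {z : ℂ}
    (hz : ‖z‖ < 1) : Summable fun ν => ‖z ^ ν * f ν‖ := by
  have hg : Summable fun ν => ‖z‖ ^ ν + ‖f ν‖ ^ 2 :=
    (summable_geometric_of_lt_one (norm_nonneg z) hz).add hf
  refine hg.of_nonneg_of_le (fun _ => norm_nonneg _) fun ν => ?_
  rw [norm_mul, norm_pow]
  have h1 : ‖z‖ ^ ν ≤ 1 := pow_le_one₀ (norm_nonneg z) hz.le
  have h0 : 0 ≤ ‖z‖ ^ ν := by positivity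
  nlinarith [sq_nonneg (‖z‖ ^ ν - ‖f ν‖), norm_nonneg (f ν)]

/-- The Cauchy product of two matrix power series with square-summable coefficients. -/
lemma seriesM_mul {r s t : ℕ} {F : ℕ → Matrix (Fin r) (Fin s) ℂ}
    {K : ℕ → Matrix (Fin s) (Fin t) ℂ} (hF : ∀ a b, Summable fun ν => ‖F ν a b‖ ^ 2)
    (hK : ∀ a b, Summable fun ν => ‖K ν a b‖ ^ 2) {z : ℂ} (hz : ‖z‖ < 1) :
    seriesM F z * seriesM K z =
      seriesM (fun n => ∑ ij ∈ Finset.HasAntidiagonal.antidiagonal n, F ij.1 * K ij.2) z := by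
  ext a b
  have hFz := fun c => summable_norm_pow_mul (hF a c) hz
  have hKz := fun c => summable_norm_pow_mul (hK c b) hz
  simp only [Matrix.mul_apply, seriesM, Matrix.of_apply]
  have hcauchy := fun c => tsum_mul_tsum_eq_tsum_sum_antidiagonal_of_summable_norm (hFz c) (hKz c)
  simp_rw [hcauchy]
  rw [← Summable.tsum_finsetSum fun c _ =>
    (summable_norm_sum_mul_antidiagonal_of_summable_norm (hFz c) (hKz c)).of_norm]
  refine tsum_congr fun n => ?_
  rw [Finset.sum_comm, Matrix.sum_apply, Finset.mul_sum]
  refine Finset.sum_congr rfl fun ij hij => ?_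
  rw [Matrix.mul_apply, Finset.mul_sum, ← Finset.HasAntidiagonal.mem_antidiagonal.1 hij]
  refine Finset.sum_congr rfl fun c _ => ?_
  ring

lemma seriesM_single_zero {p : ℕ} (z : ℂ) :
    seriesM (fun n => if n = 0 then (1 : Matrix (Fin p) (Fin p) ℂ) else 0) z = 1 := by
  ext a b
  rw [seriesM, Matrix.of_apply, tsum_eq_single 0]
  · simp
  · intro n hn
    simp [hn]

/-- Cauchy products of sequences with leading coefficient `1`. -/
lemma antidiagonal_sum_eq_ite {R : Type*} [Ring R] {F K : ℕ → R} (hF : F 0 = 1) (hK : K 0 = 1)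
    (h : ∀ N, K (N + 1) + F (N + 1) + ∑ j ∈ Finset.range N, F (N - 1 - j + 1) * K (j + 1) = 0)
    (n : ℕ) :
    ∑ ij ∈ Finset.HasAntidiagonal.antidiagonal n, F ij.1 * K ij.2 = if n = 0 then 1 else 0 := by
  cases n with
  | zero => simp [hF, hK]
  | succ N =>
    rw [← Finset.Nat.sum_antidiagonal_swap]
    simp only [Prod.fst_swap, Prod.snd_swap]
    rw [Finset.Nat.sum_antidiagonal_eq_sum_range_succ (fun i j => F j * K i),
      Finset.sum_range_succ, Finset.sum_range_succ', if_neg N.succ_ne_zero, ← h N]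
    simp only [Nat.sub_self, hF, hK, one_mul, mul_one, Nat.sub_zero]
    have : ∑ j ∈ Finset.range N, F (N + 1 - (j + 1)) * K (j + 1) =
        ∑ j ∈ Finset.range N, F (N - 1 - j + 1) * K (j + 1) := by
      refine Finset.sum_congr rfl fun j hj => ?_
      have hj := Finset.mem_range.1 hj
      rw [show N + 1 - (j + 1) = N - 1 - j + 1 by omega]
    rw [this]
    abel

/-- For `G ∈ H^∞_{m×p}` with `T_G T_G*` strictly positive, both `Y`
and `Y(·)⁻¹` belong to `H²_{p×p}`: their Taylor coefficient sequences are
square-summable in norm. -/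
theorem bezout_corona_stmt16
    (m p : ℕ) (hm : 0 < m) (hmp : m ≤ p)
    (G : ℕ → Matrix (Fin m) (Fin p) ℂ)
    (TG : l2 p →L[ℂ] l2 m)
    (hTG : ∀ (j : ℕ) (b : Fin p) (i : ℕ) (a : Fin m),
      (TG (lp.single 2 j (eVec p b))) i a = if j ≤ i then G (i - j) a b else 0)
    (HG : l2 p →L[ℂ] l2 m)
    (hHG : ∀ (j : ℕ) (b : Fin p) (i : ℕ) (a : Fin m),
      (HG (lp.single 2 j (eVec p b))) i a = G (i + j + 1) a b)
    (Tinv : l2 m →L[ℂ] l2 m)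
    (hT1 : ∀ x, Tinv (TG (TG.adjoint x)) = x)
    (hT2 : ∀ x, TG (TG.adjoint (Tinv x)) = x)
    (Yc : ℕ → Matrix (Fin p) (Fin p) ℂ)
    (hYc0 : Yc 0 = 1)
    (hYc : ∀ (ν : ℕ) (a b : Fin p),
      Yc (ν + 1) a b = -(TG.adjoint (Tinv (HG (lp.single 2 0 (eVec p b))))) ν a) :
    (∀ a b, Summable fun ν => ‖Yc ν a b‖ ^ 2) ∧
    ∃ Wc : ℕ → Matrix (Fin p) (Fin p) ℂ,
      (∀ a b, Summable fun ν => ‖Wc ν a b‖ ^ 2) ∧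
      ∀ z ∈ Metric.ball (0 : ℂ) 1,
        seriesM Yc z * seriesM Wc z = 1 ∧ seriesM Wc z * seriesM Yc z = 1 := by
  have hY : ∀ a b, Summable fun ν => ‖Yc ν a b‖ ^ 2 := fun a b => by
    rw [← summable_nat_add_iff 1]
    simpa only [hYc, norm_neg] using summable_entry_sq _ a
  refine ⟨hY, ?_⟩
  set v : ℕ → Fin p → l2 p :=
    fun N b => TG.adjoint (Tinv (HG (lp.single 2 N (eVec p b)))) with hv
  let Wc : ℕ → Matrix (Fin p) (Fin p) ℂ := fun n =>
    Nat.casesOn n 1 fun N => Matrix.of fun a b => (v N b) 0 a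
  have hW0 : Wc 0 = 1 := rfl
  have hWs : ∀ N a b, Wc (N + 1) a b = (v N b) 0 a := fun _ _ _ => rfl
  have hW : ∀ a b, Summable fun ν => ‖Wc ν a b‖ ^ 2 := fun a b => by
    rw [← summable_nat_add_iff 1]
    have hconj : ∀ N, ‖Wc (N + 1) a b‖ =
        ‖(HG.adjoint (Tinv.adjoint (TG (lp.single 2 0 (eVec p a))))) N b‖ := fun N => by
      rw [hWs, hv, ← inner_single_eVec, ← inner_single_eVec,
        ContinuousLinearMap.adjoint_inner_right, ContinuousLinearMap.adjoint_inner_right,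
        ContinuousLinearMap.adjoint_inner_right, norm_inner_symm]
    simpa only [hconj] using summable_entry_sq _ b
  refine ⟨Wc, hW, fun z hz => ?_⟩
  have hrec := state_eq_convolution v fun N b => state_succ hTG hHG hT1 hT2 N b
  have hYW : seriesM Yc z * seriesM Wc z = 1 := by
    rw [seriesM_mul hY hW (mem_ball_zero_iff.1 hz)]
    simp_rw [antidiagonal_sum_eq_ite hYc0 hW0 fun N => by
      ext a b
      simp only [Matrix.add_apply, Matrix.sum_apply, Matrix.mul_apply, Matrix.zero_apply, hWs, hYc]
      rw [hrec N 0 a b]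
      simp [hv]]
    exact seriesM_single_zero z
  exact ⟨hYW, mul_eq_one_comm.1 hYW⟩
end
end
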